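/- Let p and q be primes with p dividing q−1, let G be a finite non-abelian group of order pq, and let S be a sequence over G with |S| ≥ q + 2p − 3. Then S has a nontrivial product-one subsequence T with |T| ≤ q. -/

import Mathlib

/-- The set of all products of the terms of the multiset `S` taken in some order. -/
def prodSet {G : Type*} [Group G] (S : Multiset G) : Set G :=
  {g | ∃ l : List G, (l : Multiset G) = S ∧ l.prod = g}

/-- A sequence (multiset) over `G` is a product-one sequence if its terms can be
ordered so that their product is `1`. -/
def IsProductOne {G : Type*} [Group G] (S : Multiset G) : Prop :=
  (1 : G) ∈ prodSet S

/-- A minimal product-one sequence (atom): a nontrivial product-one sequence that cannot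
be partitioned into two nontrivial product-one subsequences. -/
def IsMinimalProductOne {G : Type*} [Group G] (S : Multiset G) : Prop :=
  S ≠ 0 ∧ IsProductOne S ∧
    ¬ ∃ T₁ T₂ : Multiset G, T₁ ≠ 0 ∧ T₂ ≠ 0 ∧ S = T₁ + T₂ ∧
      IsProductOne T₁ ∧ IsProductOne T₂

/-- The small Davenport constant: the maximal length of a sequence over `G` having
no nontrivial product-one subsequence. -/
noncomputable def smallDavenport (G : Type*) [Group G] : ℕ :=
  sSup {n | ∃ S : Multiset G, Multiset.card S = n ∧
    ∀ T : Multiset G, T ≤ S → T ≠ 0 → ¬ IsProductOne T}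

/-- The large Davenport constant: the maximal length of a minimal product-one sequence. -/
noncomputable def largeDavenport (G : Type*) [Group G] : ℕ :=
  sSup {n | ∃ S : Multiset G, Multiset.card S = n ∧ IsMinimalProductOne S}

open scoped Pointwise in
/-- Cauchy–Davenport for two subsets of fibres of a homomorphism with kernel of prime order. -/
lemma min_card_ker_le_card_mul {G C : Type*} [Group G] [Group C] [DecidableEq G] (φ : G →* C)
    (hr : (Nat.card φ.ker).Prime) {A B : Finset G} (hA : A.Nonempty) (hB : B.Nonempty) {a b : C}
    (hAa : ∀ x ∈ A, φ x = a) (hBb : ∀ x ∈ B, φ x = b) :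
    min (Nat.card φ.ker) (A.card + B.card - 1) ≤ (A * B).card := by
  classical
  obtain ⟨x₀, hx₀⟩ := hA
  obtain ⟨y₀, hy₀⟩ := hB
  let f : A → φ.ker := fun x => ⟨x₀⁻¹ * x, by
    rw [MonoidHom.mem_ker, map_mul, map_inv, hAa _ x.2, hAa _ hx₀, inv_mul_cancel]⟩
  let g : B → φ.ker := fun y => ⟨y * y₀⁻¹, by
    rw [MonoidHom.mem_ker, map_mul, map_inv, hBb _ y.2, hBb _ hy₀, mul_inv_cancel]⟩
  have hf : Function.Injective f := fun x y h =>
    Subtype.ext (mul_left_cancel (Subtype.ext_iff.1 h))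
  have hg : Function.Injective g := fun x y h =>
    Subtype.ext (mul_right_cancel (Subtype.ext_iff.1 h))
  let s := Finset.univ.image f
  let t := Finset.univ.image g
  have hs : s.card = A.card := by simp [s, Finset.card_image_of_injective _ hf]
  have ht : t.card = B.card := by simp [t, Finset.card_image_of_injective _ hg]
  have hs₀ : s.Nonempty := ⟨f ⟨x₀, hx₀⟩, Finset.mem_image_of_mem _ (Finset.mem_univ _)⟩
  have ht₀ : t.Nonempty := ⟨g ⟨y₀, hy₀⟩, Finset.mem_image_of_mem _ (Finset.mem_univ _)⟩
  have hcd := cauchy_davenport_minOrder_mul hs₀ ht₀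
  have hmin : ((Nat.card φ.ker : ℕ) : ℕ∞) ≤ Monoid.minOrder φ.ker := by
    rw [Monoid.le_minOrder]
    intro z hz _
    have : orderOf z = Nat.card φ.ker :=
      (hr.eq_one_or_self_of_dvd _ (orderOf_dvd_natCard z)).resolve_left (by simpa using hz)
    simp [this]
  have hle : (s * t).card ≤ (A * B).card := by
    refine Finset.card_le_card_of_injOn (fun z => x₀ * z * y₀) ?_ ?_
    · intro z hz
      obtain ⟨u, hu, v, hv, rfl⟩ := Finset.mem_mul.1 (Finset.mem_coe.1 hz)
      obtain ⟨x, -, rfl⟩ := Finset.mem_image.1 hu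
      obtain ⟨y, -, rfl⟩ := Finset.mem_image.1 hv
      refine Finset.mem_coe.2 (Finset.mem_mul.2 ⟨x, x.2, y, y.2, ?_⟩)
      simp [f, g, mul_assoc]
    · intro u _ v _ h
      simpa using h
  have := (min_le_min_right _ hmin).trans hcd
  rw [hs, ht] at this
  refine le_trans ?_ hle
  simpa only [min_le_iff, Nat.cast_le] using this

open scoped Pointwise in
/-- Products of `m` terms of a sequence `M` in a fibre of `φ`, when no term is repeated more than
`m` times, take at least `|M| + 1 - m` values (or fill up a fibre). -/
lemma exists_finset_prod_of_count_le {G C : Type*} [Group G] [Group C] [DecidableEq G]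
    (φ : G →* C) (hr : (Nat.card φ.ker).Prime) (c : C) (m : ℕ) (M : Multiset G)
    (hM : ∀ x ∈ M, φ x = c) (hcount : ∀ x, M.count x ≤ m) (hm : m ≤ M.card) :
    ∃ B : Finset G, min (Nat.card φ.ker) (M.card + 1 - m) ≤ B.card ∧
      ∀ b ∈ B, ∃ l : List G, l.length = m ∧ (l : Multiset G) ≤ M ∧ l.prod = b := by
  induction m generalizing M with
  | zero =>
    have : M = 0 := Multiset.eq_zero_of_forall_notMem fun x hx =>
      absurd (hcount x) (by simpa using hx)
    subst this
    exact ⟨{1}, by simp, fun b hb => ⟨[], by simp_all⟩⟩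
  | succ m ih =>
    obtain ⟨A, hfull, hsub, hA₀, hcard⟩ : ∃ A : Finset G, (∀ x, M.count x = m + 1 → x ∈ A) ∧
        A ⊆ M.toFinset ∧ A.Nonempty ∧ A.card + m ≤ M.card := by
      have hM₀ : M.toFinset.Nonempty := by
        rw [Multiset.toFinset_nonempty]; rintro rfl; simp at hm
      rcases le_total (M.toFinset.card + m) M.card with h | h
      · exact ⟨M.toFinset, fun x hx => Multiset.mem_toFinset.2
          (Multiset.count_pos.1 (by omega)), subset_rfl, hM₀, h⟩
      · let F := M.toFinset.filter (fun x => M.count x = m + 1)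
        have hF : F.card ≤ M.card - m := by
          have h1 : F.card * (m + 1) ≤ M.card := by
            rw [← Multiset.toFinset_sum_count_eq M, ← smul_eq_mul]
            calc F.card • (m + 1) = ∑ x ∈ F, M.count x := by
                  rw [Finset.sum_congr rfl (fun x hx => (Finset.mem_filter.1 hx).2), Finset.sum_const]
              _ ≤ _ := Finset.sum_le_sum_of_subset (Finset.filter_subset _ _)
          rcases Nat.eq_zero_or_pos F.card with h0 | h0
          · omega
          · have : F.card + m ≤ F.card * (m + 1) := by nlinarith
            omega
        obtain ⟨A, hFA, hA, hAc⟩ := Finset.exists_subsuperset_card_eq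
          (Finset.filter_subset _ _ : F ⊆ M.toFinset) hF (by omega)
        refine ⟨A, fun x hx => hFA (Finset.mem_filter.2 ⟨?_, hx⟩), hA, ?_, by omega⟩
        · exact Multiset.mem_toFinset.2 (Multiset.count_pos.1 (by omega))
        · rw [← Finset.card_pos]; omega
    have hAM : A.val ≤ M := (Finset.val_le_iff_val_subset.2 fun x hx =>
      Multiset.mem_toFinset.1 (hsub hx))
    have hadd : A.val + (M - A.val) = M := add_tsub_cancel_of_le hAM
    have hcardM : A.card + (M - A.val).card = M.card := by
      conv_rhs => rw [← hadd, Multiset.card_add]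
      rfl
    obtain ⟨B, hB, hBl⟩ := ih (M - A.val) (fun x hx => hM x (Multiset.mem_of_le tsub_le_self hx))
      (fun x => by
        rw [Multiset.count_sub]
        by_cases hx : x ∈ A
        · rw [Multiset.count_eq_one_of_mem A.nodup hx]
          have := hcount x
          omega
        · have h1 := hcount x
          have h2 : M.count x ≠ m + 1 := fun h => hx (hfull x h)
          omega) (by omega)
    have hB₀ : B.Nonempty := by
      rw [← Finset.card_pos]
      have := hr.pos
      omega
    have hBφ : ∀ b ∈ B, φ b = c ^ m := by
      intro b hb
      obtain ⟨l, hl, hlM, rfl⟩ := hBl b hb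
      rw [map_list_prod, List.prod_eq_pow_card _ c, List.length_map, hl]
      intro y hy
      obtain ⟨x, hx, rfl⟩ := List.mem_map.1 hy
      exact hM x (Multiset.mem_of_le (hlM.trans tsub_le_self) hx)
    have hcd := min_card_ker_le_card_mul φ hr hA₀ hB₀
      (fun x hx => hM x (Multiset.mem_of_le hAM hx)) hBφ
    refine ⟨A * B, le_trans ?_ hcd, ?_⟩
    · have := hA₀.card_pos
      omega
    · intro b hb
      obtain ⟨x, hx, y, hy, rfl⟩ := Finset.mem_mul.1 hb
      obtain ⟨l, hl, hlM, rfl⟩ := hBl y hy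
      refine ⟨x :: l, by simp [hl], ?_, by simp⟩
      rw [← hadd, ← Multiset.cons_coe, ← Multiset.singleton_add]
      exact add_le_add (Multiset.singleton_le.2 hx) hlM

/-- A sequence in a fibre of `φ` over an element of exponent `m` with enough terms, none repeated
more than `m` times, has a product-one subsequence of length `m`. -/
lemma exists_list_prod_eq_one {G C : Type*} [Group G] [Group C] [DecidableEq G]
    (φ : G →* C) (hr : (Nat.card φ.ker).Prime) {c : C} {m : ℕ} (hc : c ^ m = 1) {M : Multiset G}
    (hM : ∀ x ∈ M, φ x = c) (hcount : ∀ x, M.count x ≤ m)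
    (hm : m + Nat.card φ.ker ≤ M.card + 1) :
    ∃ l : List G, l.length = m ∧ (l : Multiset G) ≤ M ∧ l.prod = 1 := by
  have := hr.pos
  obtain ⟨B, hB, hBl⟩ := exists_finset_prod_of_count_le φ hr c m M hM hcount (by omega)
  have hBφ : (B : Set G) ⊆ φ.ker := by
    intro b hb
    obtain ⟨l, hl, hlM, rfl⟩ := hBl b hb
    rw [SetLike.mem_coe, MonoidHom.mem_ker, map_list_prod, List.prod_eq_pow_card _ c,
      List.length_map, hl, hc]
    intro y hy
    obtain ⟨x, hx, rfl⟩ := List.mem_map.1 hy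
    exact hM x (Multiset.mem_of_le hlM hx)
  have hfin : (φ.ker : Set G).Finite := Set.finite_of_ncard_ne_zero hr.ne_zero
  have hEq : (B : Set G) = φ.ker := by
    refine Set.eq_of_subset_of_ncard_le hBφ ?_ hfin
    rw [Set.ncard_coe_finset]
    have : (φ.ker : Set G).ncard = Nat.card φ.ker := rfl
    omega
  exact hBl 1 (by rw [← Finset.mem_coe, hEq]; exact one_mem _)

lemma Multiset.exists_le_card_eq {α : Type*} {s : Multiset α} {n : ℕ} (h : n ≤ s.card) :
    ∃ t ≤ s, t.card = n := by
  induction s using Quotient.inductionOn with | _ l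
  exact ⟨l.take n, Multiset.coe_le.2 (List.take_sublist _ _).subperm, by simpa using h⟩

/-- Every subsequence of `S.map φ` comes from a subsequence of `S`. -/
lemma exists_le_map_eq {α β : Type*} (φ : α → β) {S : Multiset α} {M : Multiset β}
    (h : M ≤ S.map φ) : ∃ U ≤ S, U.map φ = M := by
  classical
  induction S using Multiset.induction_on generalizing M with
  | empty => exact ⟨0, le_rfl, by simpa [eq_comm] using h⟩
  | cons a S ih =>
    rw [Multiset.map_cons] at h
    by_cases ha : φ a ∈ M
    · obtain ⟨U, hU, hUM⟩ := ih (M := M.erase (φ a)) (by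
        rwa [Multiset.erase_le_iff_le_cons])
      exact ⟨a ::ₘ U, (Multiset.cons_le_cons_iff a).2 hU, by simp [hUM, Multiset.cons_erase ha]⟩
    · obtain ⟨U, hU, hUM⟩ := ih ((Multiset.le_cons_of_notMem ha).1 h)
      exact ⟨U, hU.trans (Multiset.le_cons_self _ _), hUM⟩

/-- A sequence of minimal length among the sequences with trivial image has at least as many
products as terms, provided `1` is not one of them. -/
lemma card_le_of_minimal {G C : Type*} [Group G] [CommGroup C] (φ : G →* C)
    (hcomm : ∀ v n : G, v * n = n * v → φ n = 1 → n ≠ 1 → φ v = 1)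
    {T : Multiset G} (hT : (T.map φ).prod = 1) (hT₁ : ¬ IsProductOne T)
    (hmin : ∀ T' ≤ T, T' ≠ 0 → (T'.map φ).prod = 1 → T.card ≤ T'.card) :
    ∃ A : Finset G, T.card ≤ A.card ∧ ∀ a ∈ A, a ∈ prodSet T := by
  classical
  induction T using Quotient.inductionOn with | _ l
  change ¬ IsProductOne (l : Multiset G) at hT₁
  have key : ∀ i j, i < j → j < l.length → (l.rotate i).prod ≠ (l.rotate j).prod := by
    intro i j hij hj h
    set v := ((l.take j).drop i).prod with hv
    have htj : (l.take j).prod = (l.take i).prod * v := by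
      rw [hv, ← List.prod_append]
      conv_lhs => rw [← List.take_append_drop i (l.take j), List.take_take, min_eq_left hij.le]
    have hsub : ((l.take j).drop i).Sublist l :=
      (List.drop_sublist _ _).trans (List.take_sublist _ _)
    have hlen : ((l.take j).drop i).length = j - i := by
      simp [hj.le]
    have hvφ : φ v ≠ 1 := by
      intro h1
      have := hmin ((l.take j).drop i : List G) (Multiset.coe_le.2 hsub.subperm)
        (by
          intro h0
          have := congrArg Multiset.card h0
          simp only [Multiset.coe_card, hlen, Multiset.card_zero] at this
          omega)
        (by simpa [hv, map_list_prod] using h1)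
      have h2 : l.length ≤ ((l.take j).drop i).length := this
      omega
    have hrot : ∀ k ≤ l.length, (l.take k).prod * (l.rotate k).prod = l.prod * (l.take k).prod := by
      intro k hk
      rw [List.rotate_eq_drop_append_take hk, List.prod_append, ← mul_assoc,
        ← List.prod_append (l₁ := l.take k), List.take_append_drop]
    have h1 := hrot i (by omega)
    have h2 := hrot j hj.le
    have hne : (l.rotate i).prod ≠ 1 := fun h1 =>
      hT₁ ⟨l.rotate i, Multiset.coe_eq_coe.2 (List.rotate_perm l i), h1⟩
    refine hvφ (hcomm v (l.rotate i).prod ?_ ?_ hne)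
    · rw [← h, htj, ← mul_assoc, ← h1, mul_assoc, mul_assoc] at h2
      exact mul_left_cancel h2
    · have h3 : φ l.prod = 1 := by simpa [map_list_prod] using hT
      have := congrArg φ h1
      simpa [h3] using this
  refine ⟨(Finset.range l.length).image fun i => (l.rotate i).prod, ?_, ?_⟩
  · rw [Finset.card_image_of_injOn]
    · simp
    · intro i hi j hj h
      simp only [Finset.coe_range, Set.mem_Iio] at hi hj
      rcases lt_trichotomy i j with hlt | heq | hlt
      · exact absurd h (key i j hlt hj)
      · exact heq
      · exact absurd h.symm (key j i hlt hi)
  · intro a ha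
    obtain ⟨i, -, rfl⟩ := Finset.mem_image.1 ha
    exact ⟨l.rotate i, Multiset.coe_eq_coe.2 (List.rotate_perm l i), rfl⟩

lemma mul_mem_prodSet_add {G : Type*} [Group G] {T U : Multiset G} {a b : G}
    (ha : a ∈ prodSet T) (hb : b ∈ prodSet U) : a * b ∈ prodSet (T + U) := by
  obtain ⟨l, rfl, rfl⟩ := ha
  obtain ⟨m, rfl, rfl⟩ := hb
  exact ⟨l ++ m, by simp, by simp⟩

open scoped Pointwise in
/-- A sequence with trivial image and no product-one subsequence has many subsequence products in
the kernel. -/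
lemma exists_finset_of_no_productOne {G C : Type*} [Group G] [CommGroup C] (φ : G →* C)
    (hr : (Nat.card φ.ker).Prime)
    (hcomm : ∀ v n : G, v * n = n * v → φ n = 1 → n ≠ 1 → φ v = 1)
    (U : Multiset G) (hU : (U.map φ).prod = 1)
    (hno : ∀ T ≤ U, T ≠ 0 → ¬ IsProductOne T) :
    ∃ B : Finset G, (∀ b ∈ B, φ b = 1) ∧ U.card + 1 ≤ B.card ∧
      ∀ b ∈ B, ∃ T ≤ U, b ∈ prodSet T := by
  classical
  induction hn : U.card using Nat.strong_induction_on generalizing U with | _ n ih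
  subst hn
  rcases eq_or_ne U 0 with rfl | hU₀
  · exact ⟨{1}, by simp, by simp, fun b hb => ⟨0, le_rfl, [], by simp_all⟩⟩
  obtain ⟨T, ⟨hTU, hT₀, hTφ⟩, hmin⟩ := exists_minimalFor_of_wellFoundedLT
    (fun T : Multiset G => T ≤ U ∧ T ≠ 0 ∧ (T.map φ).prod = 1) Multiset.card
    ⟨U, le_rfl, hU₀, hU⟩
  obtain ⟨A, hA, hAT⟩ := card_le_of_minimal φ hcomm hTφ (hno T hTU hT₀) (by
    intro T' hT' h0 h1
    by_contra! hlt
    exact absurd (hmin (j := T') ⟨hT'.trans hTU, h0, h1⟩ hlt.le) (by simpa using hlt))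
  obtain ⟨U', rfl⟩ := Multiset.le_iff_exists_add.1 hTU
  have hTpos : 0 < T.card := Multiset.card_pos.2 hT₀
  obtain ⟨B, hBφ, hB, hBU⟩ := ih U'.card (by simp; omega) U'
    (by simpa [hTφ] using hU) (fun V hV => hno V (hV.trans (Multiset.le_add_left _ _))) rfl
  have hAφ : ∀ a ∈ A, φ a = 1 := by
    intro a ha
    obtain ⟨l, rfl, rfl⟩ := hAT a ha
    simpa [map_list_prod] using hTφ
  have h1A : (1 : G) ∉ A := fun h => hno T hTU hT₀ (hAT 1 h)
  have hdisj : Disjoint A⁻¹ B := by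
    rw [Finset.disjoint_left]
    intro x hx hxB
    obtain ⟨V, hV, hxV⟩ := hBU x hxB
    refine hno (T + V) (by gcongr) (by simp [hT₀]) ?_
    have := mul_mem_prodSet_add (hAT _ (Finset.mem_inv'.1 hx)) hxV
    rwa [inv_mul_cancel] at this
  have hfin : (φ.ker : Set G).Finite := Set.finite_of_ncard_ne_zero hr.ne_zero
  have hle : A.card + B.card ≤ Nat.card φ.ker := by
    rw [← Finset.card_inv A, ← Finset.card_union_of_disjoint hdisj, ← Set.ncard_coe_finset]
    refine Set.ncard_le_ncard ?_ hfin
    intro x hx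
    rw [SetLike.mem_coe, MonoidHom.mem_ker]
    rcases Finset.mem_union.1 (Finset.mem_coe.1 hx) with h | h
    · simpa using hAφ _ (Finset.mem_inv'.1 h)
    · exact hBφ x h
  have hcd := min_card_ker_le_card_mul φ hr (A := insert 1 A) (B := B)
    (Finset.insert_nonempty _ _) (Finset.card_pos.1 (by omega)) (a := 1)
    (by simpa using hAφ) hBφ
  rw [Finset.card_insert_of_notMem h1A] at hcd
  refine ⟨insert 1 A * B, ?_, ?_, ?_⟩
  · intro b hb
    obtain ⟨x, hx, y, hy, rfl⟩ := Finset.mem_mul.1 hb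
    rw [map_mul, hBφ y hy, mul_one]
    rcases Finset.mem_insert.1 hx with rfl | hx
    · simp
    · exact hAφ x hx
  · rw [Multiset.card_add]
    omega
  · intro b hb
    obtain ⟨x, hx, y, hy, rfl⟩ := Finset.mem_mul.1 hb
    obtain ⟨V, hV, hyV⟩ := hBU y hy
    rcases Finset.mem_insert.1 hx with rfl | hx
    · exact ⟨V, hV.trans (Multiset.le_add_left _ _), by simpa using hyV⟩
    · exact ⟨T + V, by gcongr, mul_mem_prodSet_add (hAT x hx) hyV⟩

/-- A sequence with trivial image and as many terms as the kernel has a product-one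
subsequence. -/
lemma exists_productOne_of_map_prod_eq_one {G C : Type*} [Group G] [CommGroup C] (φ : G →* C)
    (hr : (Nat.card φ.ker).Prime)
    (hcomm : ∀ v n : G, v * n = n * v → φ n = 1 → n ≠ 1 → φ v = 1)
    (U : Multiset G) (hU : (U.map φ).prod = 1) (hcard : Nat.card φ.ker ≤ U.card) :
    ∃ T ≤ U, T ≠ 0 ∧ IsProductOne T := by
  by_contra! hno
  obtain ⟨B, hBφ, hB, -⟩ := exists_finset_of_no_productOne φ hr hcomm U hU hno
  have hfin : (φ.ker : Set G).Finite := Set.finite_of_ncard_ne_zero hr.ne_zero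
  have : (B : Set G).ncard ≤ (φ.ker : Set G).ncard :=
    Set.ncard_le_ncard (fun x hx => hBφ x hx) hfin
  rw [Set.ncard_coe_finset] at this
  have : (φ.ker : Set G).ncard = Nat.card φ.ker := rfl
  omega

/-- A non-abelian group of order `p * q` maps onto a commutative group of order `p` with kernel
of order `q`, such that only the kernel centralizes nontrivial elements of the kernel. -/
lemma exists_hom_of_card_eq_mul.{u} {p q : ℕ} (hp : p.Prime) (hq : q.Prime) (hlt : p < q)
    {G : Type u} [Group G] [Finite G] (hG : Nat.card G = p * q)
    (hna : ¬ ∀ a b : G, a * b = b * a) :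
    ∃ (C : Type u) (_ : CommGroup C) (φ : G →* C), Nat.card C = p ∧ Nat.card φ.ker = q ∧
      ∀ v n : G, v * n = n * v → φ n = 1 → n ≠ 1 → φ v = 1 := by
  have := Fact.mk hp
  have := Fact.mk hq
  obtain ⟨x, hx⟩ := exists_prime_orderOf_dvd_card' (G := G) q (by simp [hG])
  set N := Subgroup.zpowers x with hN
  have hNq : Nat.card N = q := by rw [Nat.card_zpowers, hx]
  have hidx : N.index = p := by
    have := N.card_mul_index
    rw [hNq, hG, mul_comm] at this
    exact Nat.eq_of_mul_eq_mul_right hq.pos this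
  have hnormal : N.Normal := by
    refine Subgroup.normal_of_index_eq_minFac_card ?_
    rw [hidx, hG]
    refine le_antisymm ?_ (Nat.minFac_le_of_dvd hp.two_le (dvd_mul_right _ _))
    have hd := Nat.minFac_dvd (p * q)
    have hpr : (p * q).minFac.Prime := Nat.minFac_prime (by
      have := hp.two_le; have := hq.two_le; nlinarith)
    rcases (Nat.Prime.dvd_mul hpr).1 hd with h | h
    · exact ((Nat.prime_dvd_prime_iff_eq hpr hp).1 h).ge
    · exact ((Nat.prime_dvd_prime_iff_eq hpr hq).1 h).ge.trans' hlt.le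
  have hcyc : IsCyclic (G ⧸ N) := isCyclic_of_prime_card (p := p) hidx
  refine ⟨G ⧸ N, IsCyclic.commGroup, QuotientGroup.mk' N, hidx, ?_, ?_⟩
  · rw [QuotientGroup.ker_mk', hNq]
  · intro v n hvn hn hn1
    by_contra hv
    have hnN : n ∈ N := by rwa [← MonoidHom.mem_ker, QuotientGroup.ker_mk'] at hn
    have hvN : v ∉ N := by rwa [← QuotientGroup.ker_mk' N, MonoidHom.mem_ker]
    have hNn : N = Subgroup.zpowers n := by
      refine (Subgroup.eq_of_le_of_card_ge (by simpa using hnN) ?_).symm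
      rw [hNq, Nat.card_zpowers]
      have h1 : orderOf n ∣ q := hNq ▸ Subgroup.orderOf_dvd_natCard N hnN
      exact (((Nat.dvd_prime hq).1 h1).resolve_left (by simpa using hn1)).ge
    have hNZ : N ≤ Subgroup.centralizer {n} := by
      rw [hNn, Subgroup.zpowers_le]
      simp [Subgroup.mem_centralizer_iff]
    have htop : Subgroup.centralizer {n} = ⊤ := by
      have h1 : (Subgroup.centralizer {n}).index ∣ p := hidx ▸ Subgroup.index_dvd_of_le hNZ
      rcases (Nat.dvd_prime hp).1 h1 with h | h
      · exact Subgroup.index_eq_one.1 h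
      · have h2 := (Subgroup.centralizer {n}).card_mul_index
        rw [h, ← hidx, ← N.card_mul_index, hidx] at h2
        have h3 := Subgroup.eq_of_le_of_card_ge hNZ (Nat.eq_of_mul_eq_mul_right hp.pos h2).le
        refine absurd ?_ hvN
        rw [h3]
        simp [Subgroup.mem_centralizer_iff, hvn]
    have hNc : (QuotientGroup.mk' N).ker ≤ Subgroup.center G := by
      rw [QuotientGroup.ker_mk', hNn, Subgroup.zpowers_le, Subgroup.mem_center_iff]
      intro g
      have : g ∈ Subgroup.centralizer {n} := htop ▸ Subgroup.mem_top g
      simpa [Subgroup.mem_centralizer_iff, eq_comm] using this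
    exact hna (MonoidHom.isMulCommutative_of_isCyclic_of_ker_le_center _ hNc).is_comm.comm

/-- A long sequence over a group of prime order `p` in which no value fills almost all of the
sequence has a product-one subsequence of length exactly `m`. -/
lemma exists_le_prod_eq_one {C : Type*} [CommGroup C] [DecidableEq C] {p m : ℕ} (hp : p.Prime)
    (hC : Nat.card C = p) (hpm : p ≤ m + 1) (M : Multiset C) (hM : m + 2 * p - 3 ≤ M.card)
    (hcount : ∀ c, M.count c + 2 ≤ m + p) :
    ∃ V ≤ M, V.card = m ∧ V.prod = 1 := by
  have h2 := hp.two_le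
  obtain ⟨W, hWM, hW, hWc⟩ : ∃ W ≤ M, m + p ≤ W.card + 1 ∧ ∀ c, W.count c ≤ m := by
    by_cases h : ∀ c, M.count c ≤ m
    · exact ⟨M, le_rfl, by omega, h⟩
    push Not at h
    obtain ⟨a, ha⟩ := h
    have hsplit := Multiset.filter_add_not (fun x => x = a) M
    have hf : M.filter (fun x => x = a) = Multiset.replicate (M.count a) a :=
      Multiset.filter_eq' M a
    have hcard : M.count a + (M.filter (fun x => ¬ x = a)).card = M.card := by
      conv_rhs => rw [← hsplit, hf, Multiset.card_add, Multiset.card_replicate]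
    have hca := hcount a
    obtain ⟨R, hR, hRc⟩ := Multiset.exists_le_card_eq (s := M.filter (fun x => ¬ x = a))
      (n := p - 1) (by omega)
    refine ⟨Multiset.replicate m a + R, ?_, ?_, ?_⟩
    · rw [← hsplit, hf]
      exact add_le_add ((Multiset.replicate_le_replicate a).2 ha.le) hR
    · rw [Multiset.card_add, Multiset.card_replicate]
      omega
    · intro c
      rw [Multiset.count_add, Multiset.count_replicate]
      by_cases hca : a = c
      · subst hca
        have : R.count a = 0 := Multiset.count_eq_zero.2 fun h =>
          (Multiset.mem_filter.1 (Multiset.mem_of_le hR h)).2 rfl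
        simp [this]
      · have := Multiset.count_le_card c R
        rw [if_neg hca]
        omega
  have hker : Nat.card (1 : C →* Unit).ker = p := by
    rw [MonoidHom.ker_one, Subgroup.card_top, hC]
  obtain ⟨l, hl, hlW, hl1⟩ := exists_list_prod_eq_one (1 : C →* Unit) (hker ▸ hp) (c := 1)
    (m := m) (one_pow m) (M := W) (fun _ _ => rfl) hWc (by omega)
  exact ⟨l, hlW.trans hWM, by simpa using hl, by simpa using hl1⟩

theorem stmt13 (p q : ℕ) (hp : p.Prime) (hq : q.Prime) (hpq : p ∣ q - 1)
    (G : Type*) [Group G] [Finite G] (hG : Nat.card G = p * q)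
    (hna : ¬ ∀ a b : G, a * b = b * a)
    (S : Multiset G) (hlen : q + 2 * p - 3 ≤ Multiset.card S) :
    ∃ T : Multiset G, T ≤ S ∧ T ≠ 0 ∧ IsProductOne T ∧ Multiset.card T ≤ q := by
  classical
  have hp2 := hp.two_le
  have hq2 := hq.two_le
  have hlt : p < q := by
    have := Nat.le_of_dvd (by omega) hpq
    omega
  obtain ⟨C, _, φ, hC, hker, hcomm⟩ := exists_hom_of_card_eq_mul hp hq hlt hG hna
  have hr : (Nat.card φ.ker).Prime := hker ▸ hq
  have of_map_prod : ∀ U ≤ S, U.card = q → (U.map φ).prod = 1 →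
      ∃ T ≤ S, T ≠ 0 ∧ IsProductOne T ∧ T.card ≤ q := by
    intro U hUS hU hUφ
    obtain ⟨T, hT, hT₀, hT₁⟩ :=
      exists_productOne_of_map_prod_eq_one φ hr hcomm U hUφ (hker.trans hU.symm).le
    exact ⟨T, hT.trans hUS, hT₀, hT₁, hU ▸ Multiset.card_le_card hT⟩
  by_cases hcount : ∀ c, (S.map φ).count c + 2 ≤ q + p
  · obtain ⟨V, hV, hVq, hV₁⟩ := exists_le_prod_eq_one hp hC (by omega) (S.map φ)
      (by simpa using hlen) hcount
    obtain ⟨U, hU, rfl⟩ := exists_le_map_eq φ hV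
    exact of_map_prod U hU (by simpa using hVq) hV₁
  push Not at hcount
  obtain ⟨c, hc⟩ := hcount
  set S' := S.filter (fun x => c = φ x) with hS'
  have hS'S : S' ≤ S := Multiset.filter_le _ _
  have hS'c : ∀ x ∈ S', φ x = c := fun x hx => (Multiset.mem_filter.1 hx).2.symm
  have hcard : q + p ≤ S'.card + 1 := by
    have : (S.map φ).count c = S'.card := by rw [Multiset.count_map, hS']
    omega
  by_cases hc1 : c = 1
  · obtain ⟨U, hU, hUq⟩ := Multiset.exists_le_card_eq (s := S') (n := q) (by omega)
    refine of_map_prod U (hU.trans hS'S) hUq (Multiset.prod_eq_one fun y hy => ?_)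
    obtain ⟨x, hx, rfl⟩ := Multiset.mem_map.1 hy
    rw [hS'c x (Multiset.mem_of_le hU hx), hc1]
  have hcp : c ^ p = 1 := hC ▸ pow_card_eq_one'
  have of_list : ∀ l : List G, l.length = p → (l : Multiset G) ≤ S' → l.prod = 1 →
      ∃ T ≤ S, T ≠ 0 ∧ IsProductOne T ∧ T.card ≤ q := by
    intro l hl hlS hl1
    refine ⟨l, hlS.trans hS'S, ?_, ⟨l, rfl, hl1⟩, by simpa [hl] using hlt.le⟩
    rw [← Multiset.card_pos, Multiset.coe_card]
    omega
  by_cases hmult : ∀ x, S'.count x ≤ p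
  · obtain ⟨l, hl, hlS, hl1⟩ := exists_list_prod_eq_one φ hr hcp hS'c hmult (by omega)
    exact of_list l hl hlS hl1
  push Not at hmult
  obtain ⟨x, hx⟩ := hmult
  have hxc : φ x = c := hS'c x (Multiset.count_pos.1 (by omega))
  refine of_list (List.replicate p x) (by simp) ?_ ?_
  · rw [Multiset.coe_replicate, ← Multiset.le_count_iff_replicate_le]
    exact hx.le
  · rw [List.prod_replicate]
    by_contra hne
    exact hc1 (hxc ▸ hcomm x (x ^ p) (pow_mul_comm' x p).symm (by rw [map_pow, hxc, hcp]) hne)
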